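/- Let ξ be a non-negative random variable with Eξ = μ > 0 satisfying ℙ(|ξ − μ| > tμ) ≤ A e^{−a t² k} for all t > 0, where A ≥ 1, a > 0, k ≥ 1. Then there is an absolute constant C > 0 such that for all r ≥ 1, (E ξ^r)^{1/r} ≤ μ · √(1 + C A r / (a k)). -/

import Mathlib

open MeasureTheory ProbabilityTheory
open scoped ENNReal

lemma rh_exp_le (x : ℝ) : Real.exp x ≤ x + Real.exp (x ^ 2) := by
  have h2 := Real.add_one_le_exp (x ^ 2)
  rcases le_or_gt |x| 1 with h | h
  · have h1 := (abs_le.1 (Real.abs_exp_sub_one_sub_id_le h)).2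
    linarith
  · rcases le_or_gt 0 x with hx | hx
    · rw [abs_of_nonneg hx] at h
      have : Real.exp x ≤ Real.exp (x ^ 2) := Real.exp_le_exp.2 (by nlinarith)
      linarith
    · rw [abs_of_neg hx] at h
      have : Real.exp x ≤ 1 := Real.exp_le_one_iff.2 hx.le
      nlinarith

lemma rh_sq_exp {Ω : Type} [MeasurableSpace Ω] (P : Measure Ω) [IsProbabilityMeasure P]
    (Y : Ω → ℝ) (hY : AEMeasurable Y P) (A b : ℝ) (hA : 1 ≤ A) (hb : 0 < b)
    (h : ∀ t : ℝ, 0 < t → P {ω | t < |Y ω|} ≤ ENNReal.ofReal (A * Real.exp (-b * t ^ 2)))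
    (σ : ℝ) (hσ : 0 ≤ σ) (hσb : σ ≤ b / 2) :
    Integrable (fun ω => Real.exp (σ * Y ω ^ 2)) P ∧
      ∫ ω, Real.exp (σ * Y ω ^ 2) ∂P ≤ Real.exp (2 * A * σ / b) := by
  have hg : ∀ t : ℝ, HasDerivAt (fun t => Real.exp (σ * t)) (σ * Real.exp (σ * t)) t := by
    intro t
    have := ((hasDerivAt_id t).const_mul σ).exp
    simpa [mul_comm] using this
  have hgc : Continuous (fun t : ℝ => σ * Real.exp (σ * t)) := by fun_prop
  have key := lintegral_comp_eq_lintegral_meas_lt_mul P (f := fun ω => Y ω ^ 2)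
    (g := fun t => σ * Real.exp (σ * t)) (Filter.Eventually.of_forall fun ω => sq_nonneg _)
    (hY.pow_const 2) (fun t _ => hgc.intervalIntegrable _ _)
    (Filter.Eventually.of_forall fun t => by positivity)
  have e1 : ∀ ω, ∫ t in (0:ℝ)..(Y ω ^ 2), σ * Real.exp (σ * t) = Real.exp (σ * Y ω ^ 2) - 1 := by
    intro ω
    rw [intervalIntegral.integral_eq_sub_of_hasDerivAt (fun t _ => hg t)
      (hgc.intervalIntegrable _ _)]
    simp
  simp only [e1] at key
  have hbσ : 0 < b - σ := by linarith
  have hint : IntegrableOn (fun t : ℝ => A * σ * Real.exp (-(b - σ) * t)) (Set.Ioi 0) :=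
    (integrableOn_exp_mul_Ioi (by linarith) 0).const_mul _
  have hval : ∫ t in Set.Ioi (0:ℝ), A * σ * Real.exp (-(b - σ) * t) = A * σ / (b - σ) := by
    rw [integral_const_mul, integral_exp_mul_Ioi (by linarith) 0]
    rw [mul_zero, Real.exp_zero, neg_div_neg_eq, mul_one_div]
  have bd : ∫⁻ t in Set.Ioi (0:ℝ), P {ω | t < Y ω ^ 2} * ENNReal.ofReal (σ * Real.exp (σ * t))
      ≤ ENNReal.ofReal (A * σ / (b - σ)) := by
    rw [← hval, ofReal_integral_eq_lintegral_ofReal hint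
      (Filter.Eventually.of_forall fun t => by positivity)]
    refine setLIntegral_mono' measurableSet_Ioi fun t ht => ?_
    have ht : 0 < t := ht
    have hs : {ω | t < Y ω ^ 2} = {ω | Real.sqrt t < |Y ω|} := by
      ext ω
      simp only [Set.mem_ofPred_eq]
      rw [Real.sqrt_lt (by positivity) (abs_nonneg _), sq_abs]
    have h1 := h (Real.sqrt t) (Real.sqrt_pos.2 ht)
    rw [Real.sq_sqrt ht.le] at h1
    rw [hs]
    calc _ ≤ ENNReal.ofReal (A * Real.exp (-b * t)) * ENNReal.ofReal (σ * Real.exp (σ * t)) := by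
          gcongr
      _ = _ := by
          rw [← ENNReal.ofReal_mul (by positivity)]
          congr 1
          have : Real.exp (-(b - σ) * t) = Real.exp (-b * t) * Real.exp (σ * t) := by
            rw [← Real.exp_add]; ring_nf
          rw [this]; ring
  rw [← key] at bd
  have hnn : ∀ ω, 0 ≤ Real.exp (σ * Y ω ^ 2) - 1 := fun ω => by
    have : 0 ≤ σ * Y ω ^ 2 := by positivity
    have := Real.one_le_exp this
    linarith
  have hm : AEStronglyMeasurable (fun ω => Real.exp (σ * Y ω ^ 2) - 1) P := by
    apply AEMeasurable.aestronglyMeasurable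
    exact (Real.measurable_exp.comp_aemeasurable ((hY.pow_const 2).const_mul σ)).sub_const 1
  have hi : Integrable (fun ω => Real.exp (σ * Y ω ^ 2) - 1) P :=
    ⟨hm, by
      rw [hasFiniteIntegral_iff_ofReal (Filter.Eventually.of_forall hnn)]
      exact bd.trans_lt ENNReal.ofReal_lt_top⟩
  have hle : ∫ ω, (Real.exp (σ * Y ω ^ 2) - 1) ∂P ≤ A * σ / (b - σ) := by
    rw [integral_eq_lintegral_of_nonneg_ae (Filter.Eventually.of_forall hnn) hm]
    exact ENNReal.toReal_le_of_le_ofReal (by positivity) bd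
  have hi' : Integrable (fun ω => Real.exp (σ * Y ω ^ 2)) P := by
    refine (hi.add (integrable_const (1:ℝ))).congr (Filter.Eventually.of_forall fun ω => ?_)
    simp
  refine ⟨hi', ?_⟩
  rw [integral_sub hi' (integrable_const _)] at hle
  simp only [integral_const, probReal_univ, smul_eq_mul, mul_one] at hle
  have h3 : A * σ / (b - σ) ≤ 2 * A * σ / b := by
    rw [div_le_div_iff₀ hbσ hb]
    have : 0 ≤ A * σ := by positivity
    nlinarith
  have := Real.add_one_le_exp (2 * A * σ / b)
  linarith

lemma rh_mgf {Ω : Type} [MeasurableSpace Ω] (P : Measure Ω) [IsProbabilityMeasure P]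
    (Y : Ω → ℝ) (hY : Integrable Y P) (hY0 : ∫ ω, Y ω ∂P = 0)
    (A b : ℝ) (hA : 1 ≤ A) (hb : 0 < b)
    (h : ∀ t : ℝ, 0 < t → P {ω | t < |Y ω|} ≤ ENNReal.ofReal (A * Real.exp (-b * t ^ 2)))
    (l : ℝ) :
    Integrable (fun ω => Real.exp (l * Y ω)) P ∧
      ∫ ω, Real.exp (l * Y ω) ∂P ≤ Real.exp (3 * A * l ^ 2 / b) := by
  have hsq := rh_sq_exp P Y hY.aemeasurable A b hA hb h
  have hm : AEStronglyMeasurable (fun ω => Real.exp (l * Y ω)) P :=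
    (Real.measurable_exp.comp_aemeasurable (hY.aemeasurable.const_mul l)).aestronglyMeasurable
  have hpt : ∀ ω, Real.exp (l * Y ω) ≤
      Real.exp (l ^ 2 / (2 * b)) * Real.exp (b / 2 * Y ω ^ 2) := by
    intro ω
    rw [← Real.exp_add]
    apply Real.exp_le_exp.2
    have : l ^ 2 / (2 * b) + b / 2 * Y ω ^ 2 - l * Y ω = (l - b * Y ω) ^ 2 / (2 * b) := by
      field_simp; ring
    have : 0 ≤ (l - b * Y ω) ^ 2 / (2 * b) := by positivity
    linarith
  obtain ⟨i1, b1⟩ := hsq (b / 2) (by positivity) le_rfl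
  have hi : Integrable (fun ω => Real.exp (l * Y ω)) P := by
    refine (i1.const_mul (Real.exp (l ^ 2 / (2 * b)))).mono' hm
      (Filter.Eventually.of_forall fun ω => ?_)
    rw [Real.norm_of_nonneg (Real.exp_pos _).le]
    exact hpt ω
  refine ⟨hi, ?_⟩
  rcases le_or_gt (l ^ 2) (b / 2) with hl | hl
  · obtain ⟨i2, b2⟩ := hsq (l ^ 2) (by positivity) hl
    have : ∫ ω, Real.exp (l * Y ω) ∂P ≤ ∫ ω, (l * Y ω + Real.exp (l ^ 2 * Y ω ^ 2)) ∂P := by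
      refine integral_mono hi ((hY.const_mul l).add i2) fun ω => ?_
      have := rh_exp_le (l * Y ω)
      rwa [mul_pow] at this
    rw [integral_add (hY.const_mul l) i2, integral_const_mul, hY0, mul_zero, zero_add] at this
    refine this.trans (b2.trans (Real.exp_le_exp.2 ?_))
    gcongr
    norm_num
  · have : ∫ ω, Real.exp (l * Y ω) ∂P ≤
        ∫ ω, Real.exp (l ^ 2 / (2 * b)) * Real.exp (b / 2 * Y ω ^ 2) ∂P :=
      integral_mono hi (i1.const_mul _) hpt
    rw [integral_const_mul] at this
    refine this.trans ((mul_le_mul_of_nonneg_left b1 (Real.exp_pos _).le).trans ?_)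
    rw [← Real.exp_add]
    apply Real.exp_le_exp.2
    have e : l ^ 2 / (2 * b) + 2 * A * (b / 2) / b = (l ^ 2 / 2 + A * b) / b := by
      field_simp
    rw [e]
    gcongr
    nlinarith [mul_nonneg (sub_nonneg.2 hA) (sq_nonneg l)]

lemma rh_main {Ω : Type} [MeasurableSpace Ω] (P : Measure Ω) [IsProbabilityMeasure P]
    (Y : Ω → ℝ) (hY : Integrable Y P) (hY0 : ∫ ω, Y ω ∂P = 0) (hYn : ∀ ω, 0 ≤ 1 + Y ω)
    (A b : ℝ) (hA : 1 ≤ A) (hb : 0 < b)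
    (h : ∀ t : ℝ, 0 < t → P {ω | t < |Y ω|} ≤ ENNReal.ofReal (A * Real.exp (-b * t ^ 2)))
    (r : ℝ) (hr : 1 ≤ r) :
    ∫ ω, (1 + Y ω) ^ r ∂P ≤ (1 + 24 * A * r / b) ^ (r / 2) := by
  obtain ⟨s, hs⟩ : ∃ s, s = 24 * A * r / b := ⟨_, rfl⟩
  rw [← hs]
  have hs0 : 0 < s := by rw [hs]; positivity
  have hsb : s * b = 24 * A * r := by rw [hs]; field_simp
  obtain ⟨θ, hθ⟩ : ∃ θ, θ = r / (2 * (1 + s)) := ⟨_, rfl⟩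
  have hθ0 : 0 < θ := by rw [hθ]; positivity
  have hθr : θ ≤ r / 2 := by
    rw [hθ]; gcongr; linarith
  have hθe : θ * (2 * (1 + s)) = r := by rw [hθ]; field_simp
  have hθb : 2 * θ ≤ b / 2 := by
    have h1 : θ * (2 * s) ≤ r := by nlinarith
    have h2 : θ * (2 * s) * b ≤ r * b := by gcongr
    have h3 : θ * (48 * A) * r ≤ b * r := by nlinarith
    have h4 := le_of_mul_le_mul_right h3 (by linarith)
    nlinarith
  obtain ⟨i1, b1⟩ := rh_sq_exp P Y hY.aemeasurable A b hA hb h (2 * θ) (by positivity) hθb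
  obtain ⟨i2, b2⟩ := rh_mgf P Y hY hY0 A b hA hb h (4 * θ)
  have c1 : 2 * A * (2 * θ) / b ≤ θ * s := by
    rw [hs, div_le_iff₀ hb]
    have : θ * (24 * A * r / b) * b = θ * A * 24 * r := by field_simp
    rw [this]
    have : 0 < θ * A := by positivity
    nlinarith
  have c2 : 3 * A * (4 * θ) ^ 2 / b ≤ θ * s := by
    rw [hs, div_le_iff₀ hb]
    have : θ * (24 * A * r / b) * b = θ * A * 24 * r := by field_simp
    rw [this]
    have : 0 < θ * A := by positivity
    nlinarith
  have b1' := b1.trans (Real.exp_le_exp.2 c1)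
  have b2' := b2.trans (Real.exp_le_exp.2 c2)
  have hpt : ∀ ω, (1 + Y ω) ^ r ≤ ((1 + s) ^ (r / 2) * Real.exp (-(θ * s)) / 2) *
      (Real.exp (4 * θ * Y ω) + Real.exp (2 * θ * Y ω ^ 2)) := by
    intro ω
    obtain ⟨X, hX⟩ : ∃ X, X = 1 + Y ω := ⟨_, rfl⟩
    have hX0 : 0 ≤ X := hX ▸ hYn ω
    have q1 : (1 + Y ω) ^ r = (X ^ 2) ^ (r / 2) := by
      rw [← hX, ← Real.rpow_natCast, ← Real.rpow_mul hX0]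
      congr 1; push_cast; ring
    have q2 : X ^ 2 ≤ (1 + s) * Real.exp (X ^ 2 / (1 + s) - 1) := by
      have := Real.add_one_le_exp (X ^ 2 / (1 + s) - 1)
      rw [sub_add_cancel, div_le_iff₀ (by positivity)] at this
      linarith
    have q3 : (X ^ 2) ^ (r / 2) ≤ (1 + s) ^ (r / 2) *
        Real.exp ((X ^ 2 / (1 + s) - 1) * (r / 2)) := by
      rw [Real.exp_mul, ← Real.mul_rpow (by positivity) (by positivity)]
      gcongr
    have q4 : (X ^ 2 / (1 + s) - 1) * (r / 2) = -(θ * s) + (2 * θ * Y ω + θ * Y ω ^ 2) := by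
      rw [hX, hθ]; field_simp; ring
    rw [q4, Real.exp_add] at q3
    have q5 : Real.exp (2 * θ * Y ω + θ * Y ω ^ 2) ≤
        (Real.exp (4 * θ * Y ω) + Real.exp (2 * θ * Y ω ^ 2)) / 2 := by
      have e1 : Real.exp (4 * θ * Y ω) = Real.exp (2 * θ * Y ω) ^ 2 := by
        rw [← Real.exp_nat_mul]; congr 1; push_cast; ring
      have e2 : Real.exp (2 * θ * Y ω ^ 2) = Real.exp (θ * Y ω ^ 2) ^ 2 := by
        rw [← Real.exp_nat_mul]; congr 1; push_cast; ring
      rw [e1, e2, Real.exp_add]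
      nlinarith [sq_nonneg (Real.exp (2 * θ * Y ω) - Real.exp (θ * Y ω ^ 2))]
    rw [q1]
    refine q3.trans ?_
    calc _ ≤ (1 + s) ^ (r / 2) * (Real.exp (-(θ * s)) *
          ((Real.exp (4 * θ * Y ω) + Real.exp (2 * θ * Y ω ^ 2)) / 2)) := by gcongr
      _ = _ := by ring
  have hfin : ∫ ω, (1 + Y ω) ^ r ∂P ≤ ∫ ω, ((1 + s) ^ (r / 2) * Real.exp (-(θ * s)) / 2) *
      (Real.exp (4 * θ * Y ω) + Real.exp (2 * θ * Y ω ^ 2)) ∂P :=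
    integral_mono_of_nonneg (Filter.Eventually.of_forall fun ω => Real.rpow_nonneg (hYn ω) r)
      ((i2.add i1).const_mul _) (Filter.Eventually.of_forall hpt)
  rw [integral_const_mul, integral_add i2 i1] at hfin
  refine hfin.trans ?_
  calc _ ≤ ((1 + s) ^ (r / 2) * Real.exp (-(θ * s)) / 2) *
        (Real.exp (θ * s) + Real.exp (θ * s)) := by gcongr
    _ = (1 + s) ^ (r / 2) * (Real.exp (-(θ * s)) * Real.exp (θ * s)) := by ring
    _ = _ := by rw [← Real.exp_add]; simp

theorem reverse_holder_of_subgaussian_tail :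
    ∃ C : ℝ, 0 < C ∧
      ∀ (Ω : Type) [MeasureSpace Ω] [IsProbabilityMeasure (ℙ : Measure Ω)]
        (ξ : Ω → ℝ), (∀ ω, 0 ≤ ξ ω) →
        ∀ (μ : ℝ), μ = ∫ ω, ξ ω → 0 < μ →
        ∀ (A a k : ℝ), 1 ≤ A → 0 < a → 1 ≤ k →
        (∀ t : ℝ, 0 < t →
          ℙ {ω | t * μ < |ξ ω - μ|} ≤ ENNReal.ofReal (A * Real.exp (-a * t ^ 2 * k))) →
        ∀ r : ℝ, 1 ≤ r →
          (∫ ω, (ξ ω) ^ r) ^ (1 / r) ≤ μ * Real.sqrt (1 + C * A * r / (a * k)) := by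
  refine ⟨24, by norm_num, ?_⟩
  intro Ω _ _ ξ hξ μ hμ hμ0 A a k hA ha hk h r hr
  have hint : Integrable ξ := by
    by_contra hn
    rw [integral_undef hn] at hμ
    linarith
  have hb : 0 < a * k := by positivity
  have hYi : Integrable (fun ω => ξ ω / μ - 1) := (hint.div_const μ).sub (integrable_const 1)
  have hY0 : ∫ ω, (ξ ω / μ - 1) = 0 := by
    rw [integral_sub (hint.div_const μ) (integrable_const 1), integral_div, ← hμ]
    simp [hμ0.ne']
  have main := rh_main ℙ (fun ω => ξ ω / μ - 1) hYi hY0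
    (fun ω => by have := div_nonneg (hξ ω) hμ0.le; linarith) A (a * k) hA hb
    (fun t ht => by
      have h1 := h t ht
      have e : {ω | t < |ξ ω / μ - 1|} = {ω | t * μ < |ξ ω - μ|} := by
        ext ω
        simp only [Set.mem_ofPred_eq]
        have : ξ ω / μ - 1 = (ξ ω - μ) / μ := by field_simp
        rw [this, abs_div, abs_of_pos hμ0, lt_div_iff₀ hμ0]
      rw [e]
      convert h1 using 4
      ring) r hr
  have e : ∫ ω, (ξ ω) ^ r = μ ^ r * ∫ ω, (1 + (ξ ω / μ - 1)) ^ r := by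
    rw [← integral_const_mul]
    congr 1
    ext ω
    rw [← Real.mul_rpow hμ0.le (by have := div_nonneg (hξ ω) hμ0.le; linarith)]
    congr 1
    field_simp
    ring
  have hI : 0 ≤ ∫ ω, (1 + (ξ ω / μ - 1)) ^ r := integral_nonneg fun ω =>
    Real.rpow_nonneg (by have := div_nonneg (hξ ω) hμ0.le; linarith) r
  have hr0 : r ≠ 0 := by linarith
  have hS : 0 ≤ 1 + 24 * A * r / (a * k) := by positivity
  rw [e, Real.mul_rpow (by positivity) hI, ← Real.rpow_mul hμ0.le, mul_one_div_cancel hr0,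
    Real.rpow_one]
  gcongr
  refine (Real.rpow_le_rpow hI main (by positivity)).trans ?_
  rw [← Real.rpow_mul hS, Real.sqrt_eq_rpow]
  apply le_of_eq
  congr 1
  field_simp
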